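/- arXiv:1505.05143 — 2 statements merged into one kernel-verified Lean document; each statement's English description precedes it below -/
import Mathlib

section
/- Let $n \ge 9$ and let $H$ be a primitive subgroup of the alternating group $A_n$ (acting on $\{1, \ldots, n\}$). If $H$ contains a permutation that is a product of two disjoint transpositions, then $H = A_n$. -/
open Equiv MulAction

/-- The double transposition `(a b)(c d)` belongs to `H`. -/
def DT {α : Type*} [DecidableEq α] (H : Subgroup (Perm α)) (a b c d : α) : Prop :=
  (a ≠ b ∧ a ≠ c ∧ a ≠ d ∧ b ≠ c ∧ b ≠ d ∧ c ≠ d) ∧ swap a b * swap c d ∈ H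

section basic
variable {α : Type*} [DecidableEq α] {H : Subgroup (Perm α)}

theorem DT.s1 {a b c d : α} (h : DT H a b c d) : DT H b a c d := by
  obtain ⟨h, h'⟩ := h
  refine ⟨by grind, ?_⟩
  rwa [swap_comm b a]

theorem DT.s2 {a b c d : α} (h : DT H a b c d) : DT H c d a b := by
  obtain ⟨h, h'⟩ := h
  refine ⟨by grind, ?_⟩
  have : swap c d * swap a b = swap a b * swap c d := by
    ext x; simp only [Perm.mul_apply, swap_apply_def]; grind
  rwa [this]

theorem DT.s3 {a b c d : α} (h : DT H a b c d) : DT H a b d c := h.s2.s1.s2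

theorem DT.map {a b c d : α} (h : DT H a b c d) {g : Perm α} (hg : g ∈ H) :
    DT H (g a) (g b) (g c) (g d) := by
  obtain ⟨h, h'⟩ := h
  refine ⟨by simpa using h, ?_⟩
  have := H.mul_mem (H.mul_mem hg h') (H.inv_mem hg)
  rwa [show g * (swap a b * swap c d) * g⁻¹ = (g * swap a b * g⁻¹) * (g * swap c d * g⁻¹) by group,
    ← Equiv.swap_apply_apply, ← Equiv.swap_apply_apply] at this

theorem DT.conj {a b c d e f g h : α} (h1 : DT H a b c d) (h2 : DT H e f g h) :
    DT H ((swap a b * swap c d) e) ((swap a b * swap c d) f) ((swap a b * swap c d) g)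
      ((swap a b * swap c d) h) := h2.map h1.2

theorem DT.prod {a b c d e f : α} (h1 : DT H a b c d) (h2 : DT H a b e f)
    (h : c ≠ e ∧ c ≠ f ∧ d ≠ e ∧ d ≠ f) : DT H c d e f := by
  have h3 := H.mul_mem h1.s2.2 h2.2
  obtain ⟨h1, h1'⟩ := h1
  obtain ⟨h2, h2'⟩ := h2
  refine ⟨by grind, ?_⟩
  rw [mul_assoc, swap_mul_self_mul] at h3
  exact h3

theorem DT.three [Fintype α] (h3c : ∀ g ∈ H, ¬ g.IsThreeCycle) {a b c d f : α}
    (h1 : DT H a b c d) (h2 : DT H a b c f) : d = f := by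
  by_contra hdf
  have h3 := H.mul_mem h1.s2.2 h2.2
  rw [mul_assoc, swap_mul_self_mul] at h3
  exact h3c _ h3 (Equiv.Perm.isThreeCycle_swap_mul_swap_same h1.1.2.2.2.2.2 h2.1.2.2.2.2.2 hdf)

end basic

/-- Abstract configuration -/
structure Cfg {α : Type*} [DecidableEq α] (D : α → α → α → α → Prop) : Prop where
  ne : ∀ {a b c d}, D a b c d → a ≠ b ∧ a ≠ c ∧ a ≠ d ∧ b ≠ c ∧ b ≠ d ∧ c ≠ d
  s1 : ∀ {a b c d}, D a b c d → D b a c d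
  s2 : ∀ {a b c d}, D a b c d → D c d a b
  conj : ∀ {a b c d e f g h}, D a b c d → D e f g h →
    D ((swap a b * swap c d) e) ((swap a b * swap c d) f) ((swap a b * swap c d) g)
      ((swap a b * swap c d) h)
  prod : ∀ {a b c d e f}, D a b c d → D a b e f →
    (c ≠ e ∧ c ≠ f ∧ d ≠ e ∧ d ≠ f) → D c d e f
  three : ∀ {a b c d f}, D a b c d → D a b c f → d = f
  five : ∀ {a b c d e}, D a b c d → D a c b e → e = d

namespace Cfg
variable {α : Type*} [DecidableEq α] {D : α → α → α → α → Prop}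

theorem s3 (hD : Cfg D) {a b c d} (h : D a b c d) : D a b d c := hD.s2 (hD.s1 (hD.s2 h))

/-- supports never meet in exactly one point: first form -/
theorem one' (hD : Cfg D) {a b c d e f g} (h1 : D a b c d) (h2 : D a e f g) :
    e = b ∨ e = c ∨ e = d ∨ f = b ∨ f = c ∨ f = d ∨ g = b ∨ g = c ∨ g = d := by
  by_contra hc
  push Not at hc
  have n1 := hD.ne h1
  have n2 := hD.ne h2
  have h3 := hD.conj h2 h1
  simp only [Perm.mul_apply, swap_apply_def] at h3
  have h4 : D e b c d := by grind
  have := hD.three (hD.s2 (hD.s1 h1)) (hD.s2 (hD.s1 h4))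
  grind

/-- supports never meet in exactly three points: first form -/
theorem three' (hD : Cfg D) {a b c d e x y z} (h1 : D a b c d) (h2 : D x y z e)
    (hx : x = a ∨ x = b ∨ x = c ∨ x = d) (hy : y = a ∨ y = b ∨ y = c ∨ y = d)
    (hz : z = a ∨ z = b ∨ z = c ∨ z = d) : e = a ∨ e = b ∨ e = c ∨ e = d := by
  have n1 := hD.ne h1
  have n2 := hD.ne h2
  have key : ∀ {a b c d}, D a b c d → z = c → (x = a ∨ x = b ∨ x = c ∨ x = d) →
      (y = a ∨ y = b ∨ y = c ∨ y = d) → e = a ∨ e = b ∨ e = c ∨ e = d := by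
    intro a b c d h1 hz hx hy
    subst hz
    have n1 := hD.ne h1
    have k1 := @three _ _ _ hD
    have k2 := @five _ _ _ hD
    have h1' := hD.s1 h1
    have h1'' := hD.s3 h1
    have h1''' := hD.s1 h1''
    have h2' := hD.s1 h2
    have i1 := hD.s2 h1
    have i2 := hD.s2 h1'
    have i3 := hD.s2 h1''
    have i4 := hD.s2 h1'''
    have j1 := hD.s2 h2
    have j2 := hD.s2 h2'
    have j3 := hD.s3 h2
    have j4 := hD.s3 h2'
    have j5 := hD.s2 j3
    have j6 := hD.s2 j4
    grind
  rcases hz with hz | hz | hz | hz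
  · have := key (hD.s2 h1) hz; grind
  · have := key (hD.s3 (hD.s2 h1)) hz; grind
  · have := key h1 hz; grind
  · have := key (hD.s3 h1) hz; grind

section noV

theorem five' (hD : Cfg D)
    (hV : ∀ {a b c d}, D a b c d → ¬ D a c b d)
    {a b c d e} (h1 : D a b c d) : ¬ D a c b e := by
  intro h
  have := hD.five h1 h
  subst this
  exact hV h1 h

theorem typeB (hD : Cfg D)
    (hV : ∀ {a b c d}, D a b c d → ¬ D a c b d)
    {a b c d e f} (h1 : D a b c d) (h2 : D a e b f) : False := by
  have n1 := hD.ne h1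
  have n2 := hD.ne h2
  by_cases he : e = c
  · exact hD.five' hV h1 (he ▸ h2)
  by_cases he : e = d
  · exact hD.five' hV (hD.s3 h1) (he ▸ h2)
  by_cases hf : f = c
  · exact hD.five' hV (hD.s1 h1) (hf ▸ hD.s2 h2)
  by_cases hf : f = d
  · exact hD.five' hV (hD.s3 (hD.s1 h1)) (hf ▸ hD.s2 h2)
  have h3 := hD.conj h1 h2
  simp only [Perm.mul_apply, swap_apply_def] at h3
  have h4 : D b e a f := by grind
  exact hV (hD.s1 h2) (hD.s1 h4)

/-- distinct edges at `a` : type C -/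
theorem typeC (hD : Cfg D)
    (hV : ∀ {a b c d}, D a b c d → ¬ D a c b d)
    {a b x y e z w} (h1 : D a b x y) (h2 : D a e z w) (hbe : b ≠ e) :
    (e ≠ x ∧ e ≠ y ∧ b ≠ z ∧ b ≠ w) ∧
    ((x = z ∧ y ≠ w) ∨ (x = w ∧ y ≠ z) ∨ (y = z ∧ x ≠ w) ∨ (y = w ∧ x ≠ z)) := by
  have n1 := hD.ne h1
  have n2 := hD.ne h2
  have a1 : b ≠ z := by rintro rfl; exact hD.typeB hV h1 h2
  have a2 : b ≠ w := by rintro rfl; exact hD.typeB hV h1 (hD.s3 h2)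
  have a3 : e ≠ x := by rintro rfl; exact hD.typeB hV h2 h1
  have a4 : e ≠ y := by rintro rfl; exact hD.typeB hV h2 (hD.s3 h1)
  refine ⟨⟨a3, a4, a1, a2⟩, ?_⟩
  have o := hD.one' h1 h2
  have k1 : ¬ (x = z ∧ y = w) := by
    rintro ⟨rfl, rfl⟩
    exact hbe (hD.three (hD.s2 h1) (hD.s2 h2))
  have k2 : ¬ (x = w ∧ y = z) := by
    rintro ⟨rfl, rfl⟩
    exact hbe (hD.three (hD.s2 h1) (hD.s2 (hD.s3 h2)))
  grind

theorem uniq0 (hD : Cfg D)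
    (hV : ∀ {a b c d}, D a b c d → ¬ D a c b d)
    {a b c d e f p q} (h1 : D a b c d) (h2 : D a e c f) (hbe : b ≠ e)
    (h3 : D a b p q) : (p = c ∧ q = d) ∨ (p = d ∧ q = c) := by
  have n1 := hD.ne h1
  have n2 := hD.ne h2
  have n3 := hD.ne h3
  have t1 := hD.typeC hV h1 h2 hbe
  have t2 := hD.typeC hV h3 h2 hbe
  by_cases hp : p = c
  · subst hp; left; exact ⟨rfl, hD.three h3 h1⟩
  by_cases hp' : p = d
  · subst hp'; right; exact ⟨rfl, hD.three h3 (hD.s3 h1)⟩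
  by_cases hq : q = c
  · subst hq; exact absurd (hD.three (hD.s3 h3) h1) hp'
  by_cases hq' : q = d
  · subst hq'; exact absurd (hD.three (hD.s3 h3) (hD.s3 h1)) hp
  exfalso
  have h4 := hD.prod h1 h3 (by grind)
  have h5 := hD.s2 h2
  have : p = f ∨ q = f := by grind
  rcases this with rfl | rfl
  · exact hD.typeB hV h5 h4
  · exact hD.typeB hV h5 (hD.s3 h4)

/-- partner of an edge is unique, given degree at least two -/
theorem uniq (hD : Cfg D)
    (hV : ∀ {a b c d}, D a b c d → ¬ D a c b d)
    {a b c d e x y p q} (h1 : D a b c d) (h2 : D a e x y) (hbe : b ≠ e)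
    (h3 : D a b p q) : (p = c ∧ q = d) ∨ (p = d ∧ q = c) := by
  have t1 := (hD.typeC hV h1 h2 hbe).2
  rcases t1 with ⟨rfl, _⟩ | ⟨rfl, _⟩ | ⟨rfl, _⟩ | ⟨rfl, _⟩
  · exact hD.uniq0 hV h1 h2 hbe h3
  · exact hD.uniq0 hV h1 (hD.s3 h2) hbe h3
  · exact (hD.uniq0 hV (hD.s3 h1) h2 hbe h3).symm
  · exact (hD.uniq0 hV (hD.s3 h1) (hD.s3 h2) hbe h3).symm

/-- all partners of edges at `a` pass through the common point -/
theorem star (hD : Cfg D)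
    (hV : ∀ {a b c d}, D a b c d → ¬ D a c b d)
    (hdeg : ∀ {a b c d}, D a b c d → ∃ e x y, D a e x y ∧ b ≠ e)
    {a b c d e f p x y} (h1 : D a b c d) (h2 : D a e c f) (hbe : b ≠ e)
    (h3 : D a p x y) : x = c ∨ y = c := by
  by_cases hpb : p = b
  · subst hpb
    have := hD.uniq hV h1 h2 hbe h3
    grind
  by_cases hpe : p = e
  · subst hpe
    have := hD.uniq hV h2 h1 hbe.symm h3
    grind
  by_contra hc
  push Not at hc
  have n1 := hD.ne h1
  have n2 := hD.ne h2
  have n3 := hD.ne h3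
  have t1 := hD.typeC hV h1 h2 hbe
  have t2 := hD.typeC hV h3 h1 hpb
  have t3 := hD.typeC hV h3 h2 hpe
  have h3' : D a p d f := by
    have : (x = d ∧ y = f) ∨ (x = f ∧ y = d) := by grind
    rcases this with ⟨rfl, rfl⟩ | ⟨rfl, rfl⟩
    · exact h3
    · exact hD.s3 h3
  have h4 := hD.conj h2 h1
  simp only [Perm.mul_apply, swap_apply_def] at h4
  have h5 : D d f b e := by
    have : D e b f d := by grind
    exact hD.s3 (hD.s1 (hD.s2 this))
  obtain ⟨e', x', y', h6, h7⟩ := hdeg h5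
  have := hD.uniq hV h5 h6 h7 (hD.s2 h3')
  grind

end noV
end Cfg

section count
variable {α : Type*} [Fintype α] [DecidableEq α]

/-- A symmetric-design style count. -/
theorem count_aux (S : Finset (Finset α)) (hcard : ∀ s ∈ S, s.card = 4)
    (h1 : ∀ s ∈ S, ∀ t ∈ S, ∀ a ∈ s, a ∈ t → ∃ y, y ≠ a ∧ y ∈ s ∧ y ∈ t)
    (h3 : ∀ s ∈ S, ∀ t ∈ S, ∀ a b c, a ≠ b → a ≠ c → b ≠ c → a ∈ s → b ∈ s → c ∈ s →
      a ∈ t → b ∈ t → c ∈ t → s = t)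
    (l : ℕ) (hl : ∀ a b, a ≠ b → (S.filter (fun s => a ∈ s ∧ b ∈ s)).card = l)
    (B : Finset α) (hB : B ∈ S) (hn : 9 ≤ Fintype.card α) : False := by
  classical
  obtain ⟨a, b, hab, haB, hbB⟩ : ∃ a b, a ≠ b ∧ a ∈ B ∧ b ∈ B := by
    have : 1 < B.card := by rw [hcard B hB]; norm_num
    obtain ⟨a, ha, b, hb, hab⟩ := Finset.one_lt_card.mp this
    exact ⟨a, b, hab, ha, hb⟩
  have hlpos : 1 ≤ l := by
    rw [← hl a b hab, Nat.one_le_iff_ne_zero, ← Nat.pos_iff_ne_zero, Finset.card_pos]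
    exact ⟨B, by simp [hB, haB, hbB]⟩
  -- first double count
  have c1 : 3 * (S.filter (fun s => a ∈ s)).card = (Fintype.card α - 1) * l := by
    have := Finset.sum_card_bipartiteAbove_eq_sum_card_bipartiteBelow
      (s := S.filter (fun s => a ∈ s)) (t := Finset.univ.erase a) (r := fun s y => y ∈ s)
    rw [Finset.sum_const_nat (m := 3), Finset.sum_const_nat (m := l)] at this
    · rw [Finset.card_erase_of_mem (Finset.mem_univ _), Finset.card_univ] at this
      linarith
    · intro y hy
      rw [← hl a y (Finset.ne_of_mem_erase hy).symm, Finset.bipartiteBelow, Finset.filter_filter]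
    · intro s hs
      rw [Finset.mem_filter] at hs
      have : (Finset.univ.erase a).bipartiteAbove (fun (s : Finset α) y => y ∈ s) s = s.erase a := by
        ext y; simp [Finset.bipartiteAbove]
      rw [this, Finset.card_erase_of_mem hs.2, hcard s hs.1]
  -- second double count
  have c2 : (S.filter (fun s => a ∈ s)).card - 1 = 3 * (l - 1) := by
    have := Finset.sum_card_bipartiteAbove_eq_sum_card_bipartiteBelow
      (s := (S.filter (fun s => a ∈ s)).erase B) (t := B.erase a) (r := fun s y => y ∈ s)
    rw [Finset.sum_const_nat (m := 1), Finset.sum_const_nat (m := l - 1)] at this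
    · rw [Finset.card_erase_of_mem haB, Finset.card_erase_of_mem (by simp [hB, haB]),
        hcard B hB] at this
      linarith
    · intro y hy
      rw [Finset.mem_erase] at hy
      rw [← hl a y hy.1.symm, ← Finset.card_erase_of_mem (a := B) (by simp [hB, haB, hy.2])]
      congr 1
      ext s; simp [Finset.bipartiteBelow]; tauto
    · intro s hs
      simp only [Finset.mem_filter, Finset.mem_erase] at hs
      obtain ⟨hsB, hsS, has⟩ := hs
      obtain ⟨y, hya, hys, hyB⟩ := h1 s hsS B hB a has haB
      rw [Finset.card_eq_one]
      refine ⟨y, ?_⟩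
      ext z
      simp only [Finset.bipartiteAbove, Finset.mem_filter, Finset.mem_erase, Finset.mem_singleton]
      constructor
      · rintro ⟨⟨hza, hzB⟩, hzs⟩
        by_contra hzy
        exact hsB (h3 s hsS B hB a y z hya.symm (Ne.symm hza) (Ne.symm hzy) has hys hzs haB hyB hzB)
      · rintro rfl
        exact ⟨⟨hya, hyB⟩, hys⟩
  have hr : 1 ≤ (S.filter (fun s => a ∈ s)).card := by
    rw [Nat.one_le_iff_ne_zero, ← Nat.pos_iff_ne_zero, Finset.card_pos]
    exact ⟨B, by simp [hB, haB]⟩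
  -- disjointness bound
  have c3 : l * 2 ≤ Fintype.card α - 2 := by
    have hd : ((S.filter (fun s => a ∈ s ∧ b ∈ s)).biUnion (fun s => (s.erase a).erase b)).card
        = l * 2 := by
      rw [Finset.card_biUnion, Finset.sum_const_nat (m := 2), hl a b hab]
      · intro s hs
        simp only [Finset.mem_filter] at hs
        rw [Finset.card_erase_of_mem (by simp [hab.symm, hs.2.2]),
          Finset.card_erase_of_mem hs.2.1, hcard s hs.1]
      · intro s hs t ht hst
        replace hs := Finset.mem_filter.mp hs
        replace ht := Finset.mem_filter.mp ht
        rw [Function.onFun, Finset.disjoint_left]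
        intro z hz hz'
        simp only [Finset.mem_erase] at hz hz'
        exact hst (h3 s hs.1 t ht.1 a b z hab hz.2.1.symm hz.1.symm hs.2.1 hs.2.2 hz.2.2
          ht.2.1 ht.2.2 hz'.2.2)
    rw [← hd]
    have : Fintype.card α - 2 = ((Finset.univ.erase a).erase b).card := by
      rw [Finset.card_erase_of_mem (by simp [hab.symm]), Finset.card_erase_of_mem (by simp),
        Finset.card_univ]
      rfl
    rw [this]
    apply Finset.card_le_card
    intro z hz
    simp only [Finset.mem_biUnion, Finset.mem_erase] at hz
    obtain ⟨s, _, hz⟩ := hz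
    simp [hz.1, hz.2.1]
  obtain ⟨m, hm⟩ := Nat.exists_eq_add_of_le hn
  rw [hm] at c1 c3
  obtain ⟨k, rfl⟩ := Nat.exists_eq_add_of_le hlpos
  generalize (S.filter (fun s => a ∈ s)).card = r at *
  have e1 : r = 3 * k + 1 := by omega
  subst e1
  have e2 : 9 + m - 1 = 8 + m := by omega
  rw [e2] at c1
  have : m = 0 := by
    by_contra hm0
    have : 9 * (1 + k) ≤ (8 + m) * (1 + k) := Nat.mul_le_mul_right _ (by omega)
    omega
  subst this
  omega
end count

section main
open Pointwise
variable {n : ℕ} {H : Subgroup (Perm (Fin n))}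

theorem block_aux (hn : 9 ≤ n) (hP : IsPreprimitive H (Fin n)) (R : Fin n → Fin n → Prop)
    (hinv : ∀ g ∈ H, ∀ a b, R a b → R (g a) (g b)) (hsymm : ∀ a b, R a b → R b a)
    (hfun : ∀ a b c, R a b → R a c → b = c) (hirr : ∀ a b, R a b → a ≠ b) (a b : Fin n) : ¬ R a b := by
  intro hab
  have hb : IsBlock H ({a, b} : Set (Fin n)) := by
    rw [isBlock_iff_smul_eq_or_disjoint]
    rintro ⟨g, hg⟩
    have e : (⟨g, hg⟩ : H) • ({a, b} : Set (Fin n)) = {g a, g b} := by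
      rw [Set.smul_set_insert, Set.smul_set_singleton]; rfl
    rw [e, or_iff_not_imp_right]
    intro hnd
    have h1 := hinv g hg a b hab
    have h2 := hsymm _ _ h1
    have h3 := hsymm _ _ hab
    rw [Set.not_disjoint_iff] at hnd
    obtain ⟨x, hx, hx'⟩ := hnd
    simp only [Set.mem_insert_iff, Set.mem_singleton_iff] at hx hx'
    have := hfun (g a) (g b)
    have := hfun (g b) (g a)
    have : (g a = a ∧ g b = b) ∨ (g a = b ∧ g b = a) := by
      rcases hx with rfl | rfl <;> rcases hx' with h | h
      · left; refine ⟨h, ?_⟩; rw [h] at h1; exact hfun _ _ _ (h ▸ h1) hab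
      · right; refine ⟨h, ?_⟩; rw [h] at h1; exact hfun _ _ _ (h ▸ h1) h3
      · right; refine ⟨?_, h⟩; rw [h] at h2; exact hfun _ _ _ (h ▸ h2) hab
      · left; refine ⟨?_, h⟩; rw [h] at h2; exact hfun _ _ _ (h ▸ h2) h3
    rcases this with ⟨h, h'⟩ | ⟨h, h'⟩
    · rw [h, h']
    · rw [h, h', Set.pair_comm]
  rcases hP.isTrivialBlock_of_isBlock hb with h | h
  · exact hirr a b hab (h (by simp) (by simp))
  · have h1 : Set.ncard (Set.univ : Set (Fin n)) = n := by simp [Set.ncard_univ]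
    rw [← h] at h1
    have := Set.ncard_pair (hirr a b hab)
    omega

theorem exists_DT (hn : 9 ≤ n) (σ : Perm (Fin n)) (hσH : σ ∈ H) (hσ : σ.cycleType = {2, 2}) :
    ∃ a b c d, DT H a b c d := by
  let p : Fin 4 → Fin n := fun i => ⟨i, by omega⟩
  have hp : Function.Injective p := fun i j h => by
    simp only [p, Fin.mk.injEq] at h; exact Fin.ext h
  have hnd : [p 0, p 1, p 2, p 3].Nodup := by
    simp [hp.eq_iff]
  have h1 := Equiv.Perm.cycleType_swap_mul_swap_of_nodup hnd
  have h2 : IsConj (swap (p 0) (p 1) * swap (p 2) (p 3)) σ := by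
    rw [Equiv.Perm.isConj_iff_cycleType_eq, h1, hσ]
  rw [isConj_iff] at h2
  obtain ⟨g, hg⟩ := h2
  refine ⟨g (p 0), g (p 1), g (p 2), g (p 3), ?_, ?_⟩
  · simp [hp.eq_iff]
  · rw [Equiv.swap_apply_apply, Equiv.swap_apply_apply,
      show (g * swap (p 0) (p 1) * g⁻¹) * (g * swap (p 2) (p 3) * g⁻¹) =
        g * (swap (p 0) (p 1) * swap (p 2) (p 3)) * g⁻¹ by group, hg]
    exact hσH

theorem five_aux (hn : 9 ≤ n) (hP : IsPreprimitive H (Fin n))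
    (h3c : ∀ g ∈ H, ¬ g.IsThreeCycle) {a b c d e : Fin n}
    (h1 : DT H a b c d) (h2 : DT H a c b e) : e = d := by
  classical
  by_contra hed
  have n1 := h1.1
  have n2 := h2.1
  have hnd : [a, d, c, b, e].Nodup := by
    simp only [List.nodup_cons, List.mem_cons, List.not_mem_nil]; grind
  have hg : [a, d, c, b, e].formPerm ∈ H := by
    have : [a, d, c, b, e].formPerm = (swap a b * swap c d) * (swap a c * swap b e) := by
      ext x
      simp only [List.formPerm_cons_cons, List.formPerm_singleton, Perm.mul_apply, swap_apply_def,
        Perm.one_apply]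
      grind
    rw [this]
    exact H.mul_mem h1.2 h2.2
  have hcyc : [a, d, c, b, e].formPerm.IsCycle := List.isCycle_formPerm hnd (by simp)
  have hsupp : [a, d, c, b, e].formPerm.support.card = 5 := by
    rw [List.support_formPerm_of_nodup _ hnd (by simp), List.toFinset_card_of_nodup hnd]
    rfl
  generalize [a, d, c, b, e].formPerm = g at hg hcyc hsupp
  obtain ⟨m, rfl⟩ := Nat.exists_eq_add_of_le' hn
  have hM : IsMultiplyPreprimitive H (Fin (m + 9)) (m + 3 + 2) := by
    apply hP.isMultiplyPreprimitive (s := (g.supportᶜ : Set (Fin (m + 9))))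
    · apply Nat.add_left_cancel
      rw [Set.ncard_add_ncard_compl, Set.ncard_coe_finset, hsupp]
      simp; omega
    · simp
    have := Perm.isPretransitive_of_isCycle_mem hcyc hg
    apply IsPreprimitive.of_prime_card
    convert! Nat.prime_five
    rw [Nat.card_eq_fintype_card, Fintype.card_subtype, ← hsupp]
    apply congr_arg
    ext x
    simp [SubMulAction.mem_ofFixingSubgroup_iff]
  have hT : IsMultiplyPretransitive H (Fin (m + 9)) (m + 3 + 2) :=
    IsMultiplyPreprimitive.isMultiplyPretransitive ..
  have hT4 : IsMultiplyPretransitive H (Fin (m + 9)) 4 :=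
    isMultiplyPretransitive_of_le (n := m + 3 + 2) (by omega) (by simp)
  rw [isMultiplyPretransitive_iff] at hT4
  have i1 : Function.Injective ![a, b, c, d] := by
    intro i j; fin_cases i <;> fin_cases j <;> simp <;> grind
  have i2 : Function.Injective ![a, b, c, e] := by
    intro i j; fin_cases i <;> fin_cases j <;> simp <;> grind
  obtain ⟨⟨k, hk⟩, hke⟩ := hT4 ⟨_, i1⟩ ⟨_, i2⟩
  have q : ∀ i, k (![a, b, c, d] i) = ![a, b, c, e] i := fun i => DFunLike.congr_fun hke i
  have q0 : k a = a := q 0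
  have q1 : k b = b := q 1
  have q2 : k c = c := q 2
  have q3 : k d = e := q 3
  have h4 := h1.map hk
  rw [q0, q1, q2, q3] at h4
  exact hed (h4.three h3c h1)

theorem two_aux (hn : 9 ≤ n) (hP : IsPreprimitive H (Fin n)) {a b c d : Fin n}
    (h1 : DT H a b c d) (h2 : DT H a c b d) : IsMultiplyPretransitive H (Fin n) 2 := by
  have n1 := h1.1
  obtain ⟨m, rfl⟩ := Nat.exists_eq_add_of_le' hn
  let s : Finset (Fin (m + 9)) := {a, b, c, d}
  have hs : s.card = 4 := by
    simp only [s]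
    rw [Finset.card_insert_of_notMem, Finset.card_insert_of_notMem, Finset.card_pair] <;> simp <;>
      grind
  apply hP.is_two_pretransitive (s := (s : Set (Fin (m + 9)))ᶜ) (n := m + 4)
  · apply Nat.add_left_cancel
    rw [Set.ncard_add_ncard_compl, Set.ncard_coe_finset, hs]
    simp; omega
  · simp
  have key : ∀ x ∈ s, ∃ g ∈ H, (∀ y ∉ s, g y = y) ∧ g a = x := by
    intro x hx
    simp only [s, Finset.mem_insert, Finset.mem_singleton] at hx
    have hy : ∀ y ∉ s, y ≠ a ∧ y ≠ b ∧ y ≠ c ∧ y ≠ d := by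
      intro y hy; simpa [s] using hy
    rcases hx with rfl | rfl | rfl | rfl
    · exact ⟨1, H.one_mem, by simp, rfl⟩
    · refine ⟨_, h1.2, ?_, ?_⟩
      · intro y h; have := hy y h; simp only [Perm.mul_apply, swap_apply_def]; grind
      · simp only [Perm.mul_apply, swap_apply_def]; grind
    · refine ⟨_, h2.2, ?_, ?_⟩
      · intro y h; have := hy y h; simp only [Perm.mul_apply, swap_apply_def]; grind
      · simp only [Perm.mul_apply, swap_apply_def]; grind
    · refine ⟨_, H.mul_mem h1.2 h2.2, ?_, ?_⟩
      · intro y h; have := hy y h; simp only [Perm.mul_apply, swap_apply_def]; grind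
      · simp only [Perm.mul_apply, swap_apply_def]; grind
  rw [isPretransitive_iff]
  rintro ⟨x, hx⟩ ⟨y, hy⟩
  rw [SubMulAction.mem_ofFixingSubgroup_iff, Set.mem_compl_iff, not_not, Finset.mem_coe] at hx hy
  obtain ⟨g, hg, hgf, rfl⟩ := key x hx
  obtain ⟨k, hk, hkf, rfl⟩ := key y hy
  refine ⟨⟨⟨k * g⁻¹, H.mul_mem hk (H.inv_mem hg)⟩, ?_⟩, ?_⟩
  · rw [mem_fixingSubgroup_iff]
    intro y hy
    have hy' : y ∉ s := by simpa using hy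
    change k (g⁻¹ y) = y
    have : g⁻¹ y = y := by rw [Perm.inv_eq_iff_eq]; exact (hgf y hy').symm
    rw [this, hkf y hy']
  · apply Subtype.ext
    change k (g⁻¹ (g a)) = k a
    simp

theorem cfg_DT (hn : 9 ≤ n) (hP : IsPreprimitive H (Fin n))
    (h3c : ∀ g ∈ H, ¬ g.IsThreeCycle) : Cfg (DT H) where
  ne h := h.1
  s1 h := h.s1
  s2 h := h.s2
  conj h h' := h.conj h'
  prod h h' h'' := h.prod h' h''
  three h h' := h.three h3c h'
  five h h' := five_aux hn hP h3c h h'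

theorem exists_V4 (hn : 9 ≤ n) (hP : IsPreprimitive H (Fin n))
    (h3c : ∀ g ∈ H, ¬ g.IsThreeCycle) (hex : ∃ a b c d, DT H a b c d) :
    ∃ a b c d, DT H a b c d ∧ DT H a c b d := by
  by_contra hno
  have hV : ∀ {a b c d}, DT H a b c d → ¬ DT H a c b d := by
    intro a b c d h h'
    exact hno ⟨a, b, c, d, h, h'⟩
  have hD := cfg_DT hn hP h3c
  obtain ⟨a, b, c, d, h0⟩ := hex
  have htr : ∀ x y : Fin n, ∃ g ∈ H, g x = y := by
    intro x y
    obtain ⟨⟨g, hg⟩, h⟩ := exists_smul_eq H x y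
    exact ⟨g, hg, h⟩
  -- every vertex has two neighbours
  have hdeg0 : ∃ a b x y e z w, DT H a b x y ∧ DT H a e z w ∧ b ≠ e := by
    by_contra hno
    refine block_aux hn hP (fun a b => ∃ x y, DT H a b x y) ?_ ?_ ?_ ?_ a b ⟨c, d, h0⟩
    · rintro g hg a b ⟨x, y, h⟩; exact ⟨_, _, h.map hg⟩
    · rintro a b ⟨x, y, h⟩; exact ⟨_, _, h.s1⟩
    · rintro a b e ⟨x, y, h⟩ ⟨z, w, h'⟩
      by_contra hbe
      exact hno ⟨a, b, x, y, e, z, w, h, h', hbe⟩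
    · rintro a b ⟨x, y, h⟩; exact h.1.1
  have hdeg : ∀ {a b c d}, DT H a b c d → ∃ e x y, DT H a e x y ∧ b ≠ e := by
    intro a b c d h
    obtain ⟨a', b', x, y, e', z, w, k1, k2, k3⟩ := hdeg0
    obtain ⟨g, hg, rfl⟩ := htr a' a
    by_cases hb : b = g b'
    · exact ⟨_, _, _, k2.map hg, by rw [hb]; exact fun h => k3 (g.injective h)⟩
    · exact ⟨_, _, _, k1.map hg, hb⟩
  -- the vertex `a` with its mate `c`
  have hmate : ∃ a c b d e f, DT H a b c d ∧ DT H a e c f ∧ b ≠ e := by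
    obtain ⟨e, x, y, h1, hbe⟩ := hdeg h0
    rcases (hD.typeC hV h0 h1 hbe).2 with ⟨rfl, _⟩ | ⟨rfl, _⟩ | ⟨rfl, _⟩ | ⟨rfl, _⟩
    · exact ⟨_, _, _, _, _, _, h0, h1, hbe⟩
    · exact ⟨_, _, _, _, _, _, h0, h1.s3, hbe⟩
    · exact ⟨_, _, _, _, _, _, h0.s3, h1, hbe⟩
    · exact ⟨_, _, _, _, _, _, h0.s3, h1.s3, hbe⟩
  clear h0
  obtain ⟨a, c, b, d, e, f, h1, h2, hbe⟩ := hmate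
  refine block_aux hn hP (fun a c => a ≠ c ∧ (∀ b x y, DT H a b x y → x = c ∨ y = c) ∧
    (∀ b x y, DT H c b x y → x = a ∨ y = a)) ?_ ?_ ?_ ?_ a c ⟨h1.1.2.1, ?_, ?_⟩
  · rintro g hg a b ⟨h1, h2, h3⟩
    refine ⟨fun h => h1 (g.injective h), ?_, ?_⟩
    · intro p x y h
      have := h.map (H.inv_mem hg)
      rw [show g⁻¹ (g a) = a by simp] at this
      have := h2 _ _ _ this
      rwa [Perm.inv_eq_iff_eq, Perm.inv_eq_iff_eq] at this
    · intro p x y h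
      have := h.map (H.inv_mem hg)
      rw [show g⁻¹ (g b) = b by simp] at this
      have := h3 _ _ _ this
      rwa [Perm.inv_eq_iff_eq, Perm.inv_eq_iff_eq] at this
  · rintro a b ⟨h1, h2, h3⟩; exact ⟨h1.symm, h3, h2⟩
  · rintro a' c1 c2 ⟨k1, k2, -⟩ ⟨l1, l2, -⟩
    obtain ⟨g, hg, rfl⟩ := htr a a'
    have m1 := h1.map hg
    have m2 := h2.map hg
    have := k2 _ _ _ m1
    have := k2 _ _ _ m2
    have := l2 _ _ _ m1
    have := l2 _ _ _ m2
    have := hD.typeC hV m1 m2 (fun h => hbe (g.injective h))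
    have := m1.1
    grind
  · rintro a b ⟨h, -⟩; exact h
  · intro p x y h; exact hD.star hV hdeg h1 h2 hbe h
  · intro p x y h
    have t := hD.typeC hV h1 h2 hbe
    exact hD.star hV hdeg h1.s2 h2.s2 (by have := h1.1; have := h2.1; grind) h

theorem final_aux (hn : 9 ≤ n) (hP : IsPreprimitive H (Fin n))
    (h3c : ∀ g ∈ H, ¬ g.IsThreeCycle) (hex : ∃ a b c d, DT H a b c d) : False := by
  classical
  have hD := cfg_DT hn hP h3c
  have h2 : IsMultiplyPretransitive H (Fin n) 2 := by
    obtain ⟨a, b, c, d, h, h'⟩ := exists_V4 hn hP h3c hex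
    exact two_aux hn hP h h'
  rw [is_two_pretransitive_iff] at h2
  let S : Finset (Finset (Fin n)) :=
    Finset.univ.filter (fun s => ∃ a b c d, DT H a b c d ∧ s = {a, b, c, d})
  have hS : ∀ s, s ∈ S ↔ ∃ a b c d, DT H a b c d ∧ s = {a, b, c, d} := by
    intro s; simp [S]
  obtain ⟨a, b, c, d, h0⟩ := hex
  have n0 := h0.1
  have rot : ∀ s ∈ S, ∀ x ∈ s, ∃ b c d, DT H x b c d ∧ s = {x, b, c, d} := by
    intro s hs x hx
    obtain ⟨a, b, c, d, h, rfl⟩ := (hS s).1 hs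
    simp only [Finset.mem_insert, Finset.mem_singleton] at hx
    rcases hx with rfl | rfl | rfl | rfl
    · exact ⟨_, _, _, h, rfl⟩
    · exact ⟨_, _, _, h.s1, by ext; simp; tauto⟩
    · exact ⟨_, _, _, h.s2, by ext; simp; tauto⟩
    · exact ⟨_, _, _, h.s2.s1, by ext; simp; tauto⟩
  have hc : ∀ s ∈ S, s.card = 4 := by
    intro s hs
    obtain ⟨a, b, c, d, h, rfl⟩ := (hS s).1 hs
    have := h.1
    rw [Finset.card_insert_of_notMem, Finset.card_insert_of_notMem, Finset.card_pair] <;> simp <;> grind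
  have hsm : ∀ g ∈ H, ∀ s ∈ S, s.map g.toEmbedding ∈ S := by
    intro g hg s hs
    obtain ⟨a, b, c, d, h, rfl⟩ := (hS s).1 hs
    rw [hS]
    exact ⟨_, _, _, _, h.map hg, by simp⟩
  have hle : ∀ x y z w, x ≠ y → z ≠ w → (S.filter (fun s => x ∈ s ∧ y ∈ s)).card ≤
      (S.filter (fun s => z ∈ s ∧ w ∈ s)).card := by
    intro x y z w hxy hzw
    obtain ⟨⟨g, hg⟩, hz, hw⟩ := h2 hxy hzw
    change g x = z at hz
    change g y = w at hw
    apply Finset.card_le_card_of_injOn (fun s => s.map g.toEmbedding)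
    · intro s hs
      have hs := Finset.mem_filter.mp hs
      refine Finset.mem_coe.mpr (Finset.mem_filter.mpr ⟨hsm g hg s hs.1, ?_, ?_⟩)
      · rw [← hz]; exact Finset.mem_map_of_mem g.toEmbedding hs.2.1
      · rw [← hw]; exact Finset.mem_map_of_mem g.toEmbedding hs.2.2
    · exact (Finset.map_injective _).injOn
  refine count_aux S hc ?_ ?_ (S.filter (fun s => a ∈ s ∧ b ∈ s)).card ?_ {a, b, c, d} ?_ (by simpa)
  · intro s hs t ht x hxs hxt
    obtain ⟨p, q, r, h, rfl⟩ := rot s hs x hxs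
    obtain ⟨p', q', r', h', rfl⟩ := rot t ht x hxt
    have o := hD.one' h h'
    have m := h'.1
    simp only [Finset.mem_insert, Finset.mem_singleton]
    have e1 := m.1.symm
    have e2 := m.2.1.symm
    have e3 := m.2.2.1.symm
    have : (p' = p ∨ p' = q ∨ p' = r) ∨ (q' = p ∨ q' = q ∨ q' = r) ∨
      (r' = p ∨ r' = q ∨ r' = r) := by tauto
    rcases this with o | o | o
    · exact ⟨p', e1, Or.inr o, by simp⟩
    · exact ⟨q', e2, Or.inr o, by simp⟩
    · exact ⟨r', e3, Or.inr o, by simp⟩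
  · have hsub : ∀ s ∈ S, ∀ t ∈ S, ∀ a b c, a ≠ b → a ≠ c → b ≠ c → a ∈ s → b ∈ s → c ∈ s →
      a ∈ t → b ∈ t → c ∈ t → s ⊆ t := by
      intro s hs t ht x y z hxy hxz hyz hxs hys hzs hxt hyt hzt e he
      by_cases hex : e = x
      · rwa [hex]
      by_cases hey : e = y
      · rwa [hey]
      by_cases hez : e = z
      · rwa [hez]
      obtain ⟨p, q, r, h, rfl⟩ := rot s hs e he
      obtain ⟨a', b', c', d', h', rfl⟩ := (hS t).1 ht
      simp only [Finset.mem_insert, Finset.mem_singleton] at hxs hys hzs hxt hyt hzt ⊢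
      exact hD.three' h' h.s1.s2.s1 (by grind) (by grind) (by grind)
    intro s hs t ht x y z h1 h2 h3 h4 h5 h6 h7 h8 h9
    exact (hsub s hs t ht x y z h1 h2 h3 h4 h5 h6 h7 h8 h9).antisymm
      (hsub t ht s hs x y z h1 h2 h3 h7 h8 h9 h4 h5 h6)
  · intro x y hxy
    exact le_antisymm (hle _ _ _ _ hxy n0.1) (hle _ _ _ _ n0.1 hxy)
  · rw [hS]; exact ⟨a, b, c, d, h0, rfl⟩

end main

theorem stmt_14 (n : ℕ) (hn : 9 ≤ n) (H : Subgroup (Equiv.Perm (Fin n)))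
    (hHA : H ≤ alternatingGroup (Fin n))
    (htrans : MulAction.IsPretransitive H (Fin n))
    (hprim : ∀ B : Set (Fin n), MulAction.IsBlock H B → MulAction.IsTrivialBlock B)
    (σ : Equiv.Perm (Fin n)) (hσH : σ ∈ H) (hσ : σ.cycleType = {2, 2}) :
    H = alternatingGroup (Fin n) := by
  have hP : IsPreprimitive H (Fin n) := { isTrivialBlock_of_isBlock := fun {B} hB => hprim B hB }
  apply le_antisymm hHA
  by_contra hno
  refine final_aux hn hP ?_ (exists_DT hn σ hσH hσ)
  intro g hg h3
  exact hno (Equiv.Perm.alternatingGroup_le_of_isPreprimitive_of_isThreeCycle_mem hP h3 hg)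
end

section
/- Let $n \ge 9$ with $n = p^a$ a power of an odd prime $p$. Let $r$ be a prime with $n/2 < r < n - 2$, let $x \in A_n$ be an $r$-cycle, and let $y \in A_n$ be an $n$-cycle. Then $\langle x, y \rangle = A_n$. -/
open MulAction Equiv Equiv.Perm Pointwise

lemma sylow_conj_aux {K : Type*} [Group K] [Finite K] (r : ℕ) [hr : Fact r.Prime]
    (hK : ¬ r ^ 2 ∣ Nat.card K) (u v : K) (hu : orderOf u = r) (hv : orderOf v = r) :
    ∃ h : K, ∃ i : ℤ, h * v * h⁻¹ = u ^ i := by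
  have hf : (Nat.card K).factorization r = 1 := by
    apply le_antisymm
    · by_contra hcon
      apply hK
      rw [hr.out.pow_dvd_iff_le_factorization Nat.card_pos.ne']
      omega
    · rw [← hr.out.pow_dvd_iff_le_factorization Nat.card_pos.ne', pow_one, ← hu]
      exact orderOf_dvd_natCard u
  let P : Sylow r K := Sylow.ofCard (Subgroup.zpowers u) (by rw [hf, Nat.card_zpowers, hu, pow_one])
  let Q : Sylow r K := Sylow.ofCard (Subgroup.zpowers v) (by rw [hf, Nat.card_zpowers, hv, pow_one])
  obtain ⟨h, hh⟩ := exists_smul_eq K Q P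
  have h1 : h * v * h⁻¹ ∈ (h • Q : Sylow r K) := by
    have : v ∈ (Q : Subgroup K) := Subgroup.mem_zpowers v
    exact Subgroup.smul_mem_pointwise_smul v (MulAut.conj h) _ this
  rw [hh] at h1
  obtain ⟨i, hi⟩ := Subgroup.mem_zpowers_iff.mp (show h * v * h⁻¹ ∈ Subgroup.zpowers u from h1)
  exact ⟨h, i, hi.symm⟩

lemma prim_fix_aux {α : Type*} [Fintype α] [DecidableEq α] {G : Subgroup (Perm α)} {x : Perm α}
    (hc : x.IsCycle) (hx : x ∈ G) {r : ℕ} (hr : r.Prime) (hs : x.support.card = r) :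
    IsPreprimitive (fixingSubgroup G (x.support : Set α)ᶜ)
      (SubMulAction.ofFixingSubgroup G (x.support : Set α)ᶜ) := by
  classical
  have := isPretransitive_of_isCycle_mem hc hx
  apply IsPreprimitive.of_prime_card
  convert! hr
  rw [Nat.card_eq_fintype_card, Fintype.card_subtype, ← hs]
  apply congr_arg
  ext x
  simp [SubMulAction.mem_ofFixingSubgroup_iff]

/-- elements of `G` inducing a prescribed permutation on the fixed points of `x`
and normalizing `⟨x⟩`. -/
lemma witt_aux {α : Type*} [Fintype α] [DecidableEq α] {G : Subgroup (Perm α)} {x : Perm α}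
    (hx : x ∈ G) {r k : ℕ} (hr : r.Prime) (hs : orderOf x = r)
    (hsq : ¬ r ^ 2 ∣ (Fintype.card α).factorial)
    (hk : x.supportᶜ.card = k) (ht : IsMultiplyPretransitive G α k)
    (σ : Perm α) (hσ : ∀ d, x d = d → x (σ d) = σ d) :
    ∃ g ∈ G, (∀ d, x d = d → g d = σ d) ∧ ∃ i : ℤ, g * x * g⁻¹ = x ^ i := by
  have : Fact r.Prime := ⟨hr⟩
  let e := x.supportᶜ.equivFinOfCardEq hk
  let f1 : Fin k ↪ α := ⟨fun i => (e.symm i : α), fun i j h => e.symm.injective (Subtype.ext h)⟩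
  let f2 : Fin k ↪ α := f1.trans σ.toEmbedding
  obtain ⟨g, hg⟩ := exists_smul_eq G f1 f2
  have hgd : ∀ d, x d = d → (g : Perm α) d = σ d := by
    intro d hd
    have hd' : d ∈ x.supportᶜ := by simpa using hd
    have := DFunLike.congr_fun hg (e ⟨d, hd'⟩)
    have h1 : f1 (e ⟨d, hd'⟩) = d := by
      change ((e.symm (e ⟨d, hd'⟩) : { z // z ∈ x.supportᶜ }) : α) = d
      rw [Equiv.symm_apply_apply]
    change (g : Perm α) (f1 (e ⟨d, hd'⟩)) = σ (f1 (e ⟨d, hd'⟩)) at this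
    rwa [h1] at this
  have hgi : ∀ d, x d = d → x ((g : Perm α)⁻¹ d) = (g : Perm α)⁻¹ d := by
    -- finite set stabilised by an injective map
    intro d hd
    have hsurj : Set.SurjOn (g : Perm α) (x.supportᶜ : Finset α) (x.supportᶜ : Finset α) := by
      apply Finset.surjOn_of_injOn_of_card_le
      · intro d hd
        have hd : x d = d := by simpa using hd
        simpa [hgd d hd] using hσ d hd
      · exact (g : Perm α).injective.injOn
      · exact le_rfl
    obtain ⟨c, hc, hcd⟩ := hsurj (show d ∈ ((x.supportᶜ : Finset α) : Set α) by simpa using hd)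
    rw [← hcd]
    simpa using hc
  let H : Subgroup (Perm α) := G ⊓ fixingSubgroup (Perm α) ({d | x d = d} : Set α)
  have hH : ∀ u, u ∈ H ↔ u ∈ G ∧ ∀ d, x d = d → u d = d := by
    intro u
    simp [H, mem_fixingSubgroup_iff]
  let u : H := ⟨x, (hH x).2 ⟨hx, fun d hd => hd⟩⟩
  let v : H := ⟨(g : Perm α) * x * (g : Perm α)⁻¹, (hH _).2
    ⟨G.mul_mem (G.mul_mem g.2 hx) (G.inv_mem g.2), fun d hd => by
      rw [Perm.mul_apply, Perm.mul_apply, hgi d hd, ← Perm.mul_apply, mul_inv_cancel, Perm.one_apply]⟩⟩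
  obtain ⟨h, i, hi⟩ := sylow_conj_aux (K := H) r (fun hdvd => hsq (by
      have := hdvd.trans (Subgroup.card_subgroup_dvd_card H)
      rwa [Nat.card_perm, Nat.card_eq_fintype_card] at this)) u v
      (by rw [← hs]; exact Subgroup.orderOf_mk _ _)
      (by
        rw [← hs]
        refine (Subgroup.orderOf_mk _ _).trans ?_
        exact orderOf_injective (MulAut.conj (g : Perm α)).toMonoidHom
          (MulAut.conj (g : Perm α)).injective x)
  have hh := (hH h).1 h.2
  refine ⟨h * g, G.mul_mem hh.1 g.2, ?_, i, ?_⟩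
  · intro d hd
    rw [Perm.mul_apply, hgd d hd, hh.2 _ (hσ d hd)]
  · have := congrArg (Subtype.val) hi
    simpa [u, v, mul_assoc] using this

lemma comm_aux {K : Type*} [Group K] {x g h : K} {i j : ℤ} (hg : g * x * g⁻¹ = x ^ i)
    (hh : h * x * h⁻¹ = x ^ j) : Commute (g⁻¹ * h⁻¹ * g * h) x := by
  have key : (g * h) * x * (g * h)⁻¹ = (h * g) * x * (h * g)⁻¹ := by
    have e1 : (g * h) * x * (g * h)⁻¹ = g * (h * x * h⁻¹) * g⁻¹ := by group
    have e2 : (h * g) * x * (h * g)⁻¹ = h * (g * x * g⁻¹) * h⁻¹ := by group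
    rw [e1, e2, hg, hh, ← conj_zpow, ← conj_zpow, hg, hh, ← zpow_mul, ← zpow_mul, mul_comm]
  have k2 : (g⁻¹ * h⁻¹ * g * h) * x * (g⁻¹ * h⁻¹ * g * h)⁻¹ = x := by
    calc _ = (h * g)⁻¹ * ((g * h) * x * (g * h)⁻¹) * (h * g) := by group
      _ = (h * g)⁻¹ * ((h * g) * x * (h * g)⁻¹) * (h * g) := by rw [key]
      _ = x := by group
  exact mul_inv_eq_iff_eq_mul.1 k2

lemma jordan_aux {α : Type*} [Fintype α] [DecidableEq α] {G : Subgroup (Perm α)} {x : Perm α}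
    (hx : x ∈ G) {r : ℕ} (hr : r.Prime) (hc : x.IsCycle) (hs : x.support.card = r)
    (hsq : ¬ r ^ 2 ∣ (Fintype.card α).factorial) (h3 : r + 3 ≤ Fintype.card α)
    (hG : IsPreprimitive G α) : alternatingGroup α ≤ G := by
  have hcard : x.supportᶜ.card = Fintype.card α - r := by rw [Finset.card_compl, hs]
  obtain ⟨m, hm⟩ : ∃ m, Fintype.card α = r + (m + 3) := ⟨Fintype.card α - r - 3, by omega⟩
  have hcard' : x.supportᶜ.card = m + 3 := by omega
  have hr2 := hr.two_le
  have ht : IsMultiplyPretransitive G α (m + 3) := by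
    have : IsMultiplyPreprimitive G α (m + 2 + 2) := by
      apply hG.isMultiplyPreprimitive (s := (x.support : Set α)ᶜ)
      · rw [← Finset.coe_compl, Set.ncard_coe_finset, hcard']
      · rw [Nat.card_eq_fintype_card]; omega
      · exact prim_fix_aux hc hx hr hs
    have := this.isMultiplyPretransitive
    apply isMultiplyPretransitive_of_le (n := m + 2 + 2) (by omega)
    rw [Nat.card_eq_fintype_card]; omega
  obtain ⟨a, b, c, ha, hb, hcc, hab, hac, hbc⟩ :=
    (Finset.two_lt_card (s := x.supportᶜ)).1 (by omega) |> fun ⟨a, ha, b, hb, c, hc, h1, h2, h3⟩ =>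
      (⟨a, b, c, ha, hb, hc, h1, h2, h3⟩ : ∃ a b c, a ∈ x.supportᶜ ∧ b ∈ x.supportᶜ ∧
        c ∈ x.supportᶜ ∧ a ≠ b ∧ a ≠ c ∧ b ≠ c)
  have ha' : x a = a := by simpa using ha
  have hb' : x b = b := by simpa using hb
  have hc' : x c = c := by simpa using hcc
  have ho : orderOf x = r := by rw [hc.orderOf, hs]
  have hσ : ∀ u v : α, x u = u → x v = v → ∀ d, x d = d → x (swap u v d) = swap u v d := by
    intro u v hu hv d hd
    rw [swap_apply_def]; split_ifs <;> assumption
  obtain ⟨g, hgG, hgd, i, hgi⟩ := witt_aux hx hr ho hsq hcard' ht (swap a b) (hσ a b ha' hb')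
  obtain ⟨h, hhG, hhd, j, hhj⟩ := witt_aux hx hr ho hsq hcard' ht (swap a c) (hσ a c ha' hc')
  have hgd' : ∀ d, x d = d → g⁻¹ d = swap a b d := by
    intro d hd
    rw [Perm.inv_eq_iff_eq, hgd _ (hσ a b ha' hb' d hd), swap_apply_self]
  have hhd' : ∀ d, x d = d → h⁻¹ d = swap a c d := by
    intro d hd
    rw [Perm.inv_eq_iff_eq, hhd _ (hσ a c ha' hc' d hd), swap_apply_self]
  set w := g⁻¹ * h⁻¹ * g * h with hw
  have hwG : w ∈ G := G.mul_mem (G.mul_mem (G.mul_mem (G.inv_mem hgG) (G.inv_mem hhG)) hgG) hhG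
  have hcomm : Commute w x := comm_aux hgi hhj
  have hwd : ∀ d, x d = d → w d = (swap a b * swap a c * (swap a b * swap a c)) d := by
    intro d hd
    have e1 := hσ a c ha' hc' d hd
    have e2 := hσ a b ha' hb' _ e1
    have e3 := hσ a c ha' hc' _ e2
    simp only [hw, Perm.mul_apply]
    rw [hhd d hd, hgd _ e1, hhd' _ e2, hgd' _ e3]
  -- `w` is a power of `x` on the support
  obtain ⟨s0, hs0, hcyc⟩ := hc
  have hws0 : x (w s0) ≠ w s0 := by
    intro hcon
    have : w (x s0) = w s0 := by
      rw [← Perm.mul_apply, hcomm.eq, Perm.mul_apply, hcon]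
    exact hs0 (w.injective this)
  obtain ⟨k, hk⟩ := hcyc hws0
  have hwx : ∀ d, x d ≠ d → w d = (x ^ k) d := by
    intro d hd
    obtain ⟨l, rfl⟩ := hcyc hd
    rw [← Perm.mul_apply, (hcomm.zpow_right l).eq, Perm.mul_apply, ← hk, ← Perm.mul_apply,
      ← Perm.mul_apply, ← zpow_add, ← zpow_add, add_comm]
  have h3c : (swap a b * swap a c * (swap a b * swap a c)).IsThreeCycle :=
    (isThreeCycle_swap_mul_swap_same hab hac hbc).isThreeCycle_sq
  have hfix : ∀ (l : ℤ) d, x d = d → (x ^ l) d = d := fun l d hd =>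
    zpow_apply_eq_self_of_apply_eq_self hd l
  have hmem : swap a b * swap a c * (swap a b * swap a c) ∈ G := by
    have : swap a b * swap a c * (swap a b * swap a c) = w * (x ^ k)⁻¹ := by
      rw [eq_mul_inv_iff_mul_eq]
      ext d : 1
      by_cases hd : x d = d
      · rw [Perm.mul_apply, hfix k d hd, hwd d hd]
      · rw [hwx d hd, Perm.mul_apply]
        have h1 : x ((x ^ k) d) ≠ (x ^ k) d := by
          intro hcon
          apply hd
          apply (x ^ k).injective
          rw [← Perm.mul_apply, ((Commute.refl x).zpow_left k).eq, Perm.mul_apply, hcon]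
        have na : (x ^ k) d ≠ a := fun e => h1 (by rw [e, ha'])
        have nb : (x ^ k) d ≠ b := fun e => h1 (by rw [e, hb'])
        have nc : (x ^ k) d ≠ c := fun e => h1 (by rw [e, hc'])
        simp only [Perm.mul_apply, swap_apply_of_ne_of_ne na nc, swap_apply_of_ne_of_ne na nb]
    rw [this]
    exact G.mul_mem hwG (G.inv_mem (G.zpow_mem hx k))
  exact alternatingGroup_le_of_isPreprimitive_of_isThreeCycle_mem hG h3c hmem

lemma prim_aux {α : Type*} [Fintype α] [DecidableEq α] {G : Subgroup (Perm α)} {x : Perm α}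
    (hx : x ∈ G) {r : ℕ} (hr : r.Prime) (hc : x.IsCycle) (hs : x.support.card = r)
    (h2 : Fintype.card α < r * 2) (hG : IsPretransitive G α) : IsPreprimitive G α := by
  obtain ⟨s, hsx, -⟩ := id hc
  apply IsPreprimitive.of_isTrivialBlock_base s
  intro B hsB hB
  have hp := prim_fix_aux hc hx hr hs
  have hB' : IsBlock (fixingSubgroup G (x.support : Set α)ᶜ) B := hB.subgroup
  have hss : s ∈ SubMulAction.ofFixingSubgroup G (x.support : Set α)ᶜ := by
    simpa [SubMulAction.mem_ofFixingSubgroup_iff] using hsx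
  have hxss : x s ∈ SubMulAction.ofFixingSubgroup G (x.support : Set α)ᶜ := by
    simpa [SubMulAction.mem_ofFixingSubgroup_iff] using hsx
  rcases (hB'.subtype_val_preimage
    (C := SubMulAction.ofFixingSubgroup G (x.support : Set α)ᶜ)).subsingleton_or_eq_univ with h | h
  · left
    have hne : (⟨x, hx⟩ : G) • B ≠ B := by
      intro hcon
      have : x s ∈ B := by
        rw [← hcon]; exact Set.smul_mem_smul_set (a := (⟨x, hx⟩ : G)) hsB
      have := h (x := ⟨x s, hxss⟩) this (y := ⟨s, hss⟩) hsB
      exact hsx (congrArg Subtype.val this)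
    have hdis := (isBlock_iff_smul_eq_or_disjoint.1 hB (⟨x, hx⟩ : G)).resolve_left hne
    have hsub : ∀ d ∈ B, d ∈ SubMulAction.ofFixingSubgroup G (x.support : Set α)ᶜ := by
      intro d hd
      have : x d ≠ d := fun hcon => Set.disjoint_left.1 hdis
        (show d ∈ (⟨x, hx⟩ : G) • B from ⟨d, hd, hcon⟩) hd
      simpa [SubMulAction.mem_ofFixingSubgroup_iff] using this
    intro d hd e he
    exact congrArg Subtype.val (h (x := ⟨d, hsub d hd⟩) hd (y := ⟨e, hsub e he⟩) he)
  · right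
    apply hB.eq_univ_of_card_lt
    have : r ≤ B.ncard := by
      rw [← hs, ← Set.ncard_coe_finset]
      apply Set.ncard_le_ncard _ (Set.toFinite _)
      intro d hd
      have hd' : d ∈ SubMulAction.ofFixingSubgroup G (x.support : Set α)ᶜ := by
        simpa [SubMulAction.mem_ofFixingSubgroup_iff] using hd
      have : (⟨d, hd'⟩ : SubMulAction.ofFixingSubgroup G (x.support : Set α)ᶜ) ∈
        (Subtype.val ⁻¹' B : Set _) := by rw [h]; trivial
      exact this
    rw [Nat.card_eq_fintype_card]; omega

theorem stmt_16 (n p a r : ℕ) (hn : 9 ≤ n) (hp : p.Prime) (hpodd : Odd p)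
    (ha : 1 ≤ a) (hna : n = p ^ a) (hr : r.Prime) (hr1 : n < 2 * r)
    (hr2 : r < n - 2) (x y : Equiv.Perm (Fin n))
    (hxA : x ∈ alternatingGroup (Fin n)) (hyA : y ∈ alternatingGroup (Fin n))
    (hx : x.cycleType = {r}) (hy : y.cycleType = {n}) :
    Subgroup.closure {x, y} = alternatingGroup (Fin n) := by
  have hxc : x.IsCycle := card_cycleType_eq_one.1 (by simp [hx])
  have hyc : y.IsCycle := card_cycleType_eq_one.1 (by simp [hy])
  have hxs : x.support.card = r := by rw [← sum_cycleType, hx]; simp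
  have hys : y.support.card = n := by rw [← sum_cycleType, hy]; simp
  have hyu : y.support = Finset.univ := by
    rw [← Finset.card_eq_iff_eq_univ, hys, Fintype.card_fin]
  apply le_antisymm
  · rw [Subgroup.closure_le]
    rintro z (rfl | rfl) <;> assumption
  have hxG : x ∈ Subgroup.closure {x, y} := Subgroup.subset_closure (by simp)
  have hyG : y ∈ Subgroup.closure {x, y} := Subgroup.subset_closure (by simp)
  have htr : IsPretransitive (Subgroup.closure {x, y}) (Fin n) := by
    constructor
    intro u v
    have hmv : ∀ u, y u ≠ u := fun u => by rw [← mem_support, hyu]; simp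
    obtain ⟨i, hi⟩ := hyc.exists_zpow_eq (hmv u) (hmv v)
    exact ⟨⟨y ^ i, Subgroup.zpow_mem _ hyG i⟩, hi⟩
  refine jordan_aux hxG hr hxc hxs ?_ (by rw [Fintype.card_fin]; omega)
    (prim_aux hxG hr hxc hxs (by rw [Fintype.card_fin]; omega) htr)
  rw [Fintype.card_fin, hr.pow_dvd_factorial_iff (b := 2)]
  · have : n / r < 2 := Nat.div_lt_of_lt_mul (by omega)
    simpa using this
  · apply Nat.log_lt_of_lt_pow (by omega)
    nlinarith [hr.two_le]
end
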